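/- Under assumptions (A2) and (A4), for every T ≥ 1 the AdaGrad-Norm iterates satisfy E[ln(1 + v_T/λ²)] ≤ 2 ln(1 + (√2·‖σ‖_p·T^{1/p} + E[√(2u_T)])/λ) ≤ 2 ln K_T, where u_T = ∑_{t=1}^T ‖∇f(x_t)‖₂² and K_T = 1 + (√2·‖σ‖_p·T^{1/p} + 2‖∇f(x₁)‖₂·T^{1/2} + 2γ‖L‖_∞·T^{3/2})/λ. -/

import Mathlib

open MeasureTheory Finset

/-- The AdaGrad-Norm accumulator `v_t = ∑_{s=1}^t ‖g_s‖₂²`. -/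
noncomputable def adaNormV {Ω : Type} {d : ℕ} (g : ℕ → Ω → EuclideanSpace ℝ (Fin d))
    (t : ℕ) (ω : Ω) : ℝ :=
  ∑ s ∈ Finset.Icc 1 t, ‖g s ω‖ ^ 2

/-- The natural filtration `F_t = σ(g_1, …, g_t)`. -/
noncomputable def natFilt {Ω : Type} [MeasurableSpace Ω] {d : ℕ}
    (g : ℕ → Ω → EuclideanSpace ℝ (Fin d)) (t : ℕ) : MeasurableSpace Ω :=
  ⨆ s ∈ Finset.Icc 1 t, MeasurableSpace.comap (g s) inferInstance

/-- A two-sided quadratic bound on the first-order remainder makes the gradient Lipschitz, with the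
same constant. -/
theorem norm_gradient_sub_le_of_abs_remainder_le {E : Type*} [NormedAddCommGroup E]
    [InnerProductSpace ℝ E] {f : E → ℝ} {G : E → E} {M : ℝ} (hM : 0 < M)
    (h : ∀ u v, |f u - f v - inner ℝ (G v) (u - v)| ≤ M / 2 * ‖u - v‖ ^ 2) (y z : E) :
    ‖G y - G z‖ ≤ M * ‖y - z‖ := by
  set e : E := -((1 / (2 * M)) • (G y - G z)) with he
  set k : E := (1 / 2 : ℝ) • (z - y) with hk
  have remainder_bounds : ∀ (w a : E) (b : E), w - a = b →
      f w - f a - inner ℝ (G a) b ≤ M / 2 * ‖b‖ ^ 2 ∧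
        -(M / 2 * ‖b‖ ^ 2) ≤ f w - f a - inner ℝ (G a) b := by
    rintro w a b rfl
    exact ⟨(abs_le.1 (h w a)).2, (abs_le.1 (h w a)).1⟩
  have hzy : z = y + (k + k) := by
    rw [hk, ← add_smul]; norm_num
  have upper_y := (remainder_bounds (y + (k + e)) y (k + e) (by abel)).1
  have lower_z := (remainder_bounds (y + (k + e)) z (e - k) (by rw [hzy]; abel)).2
  have lower_y := (remainder_bounds (y + (k - e)) y (k - e) (by abel)).2
  have upper_z := (remainder_bounds (y + (k - e)) z (-(k + e)) (by rw [hzy]; abel)).1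
  have parallelogram := parallelogram_law_with_norm ℝ k e
  rw [norm_sub_rev e k] at lower_z
  rw [norm_neg] at upper_z
  simp only [inner_add_right, inner_sub_right, inner_neg_right] at upper_y lower_z lower_y upper_z
  have hinner : inner ℝ (G y) e - inner ℝ (G z) e = -(1 / (2 * M) * ‖G y - G z‖ ^ 2) := by
    rw [← inner_sub_left, he, inner_neg_right, inner_smul_right, real_inner_self_eq_norm_sq]
  have hek : ‖e‖ = 1 / (2 * M) * ‖G y - G z‖ := by
    rw [he, norm_neg, norm_smul, Real.norm_of_nonneg (by positivity)]
  have hkn : ‖k‖ = 1 / 2 * ‖y - z‖ := by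
    rw [hk, norm_smul, norm_sub_rev z y]; norm_num
  have key : 0 ≤ 2 * (inner ℝ (G y) e - inner ℝ (G z) e) + 2 * M * (‖k‖ ^ 2 + ‖e‖ ^ 2) := by
    linear_combination upper_y + lower_z + lower_y + upper_z + M * parallelogram
  rw [hinner, hek, hkn] at key
  have hsq : ‖G y - G z‖ ^ 2 ≤ (M * ‖y - z‖) ^ 2 := by
    have : 2 * -(1 / (2 * M) * ‖G y - G z‖ ^ 2) +
        2 * M * ((1 / 2 * ‖y - z‖) ^ 2 + (1 / (2 * M) * ‖G y - G z‖) ^ 2) =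
        ((M * ‖y - z‖) ^ 2 - ‖G y - G z‖ ^ 2) / (2 * M) := by
      field_simp
      ring
    rw [this] at key
    have := (div_nonneg_iff.1 key).resolve_right (fun h => by linarith [h.2])
    linarith [this.1]
  exact le_of_sq_le_sq hsq (by positivity)

/-- The `ℓ²` norm is at most the `ℓᵖ` norm for `p ≤ 2`. -/
theorem sqrt_sum_sq_le_rpow_sum_rpow {ι : Type*} (s : Finset ι) (a : ι → ℝ)
    {p : ℝ} (hp0 : 0 < p) (hp2 : p ≤ 2) :
    Real.sqrt (∑ j ∈ s, a j ^ 2) ≤ (∑ j ∈ s, |a j| ^ p) ^ (1 / p) := by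
  set S := ∑ j ∈ s, |a j| ^ p with hS
  have hS0 : 0 ≤ S := Finset.sum_nonneg fun j _ => by positivity
  have hR0 : 0 ≤ S ^ (1 / p) := by positivity
  have hRp : (S ^ (1 / p)) ^ p = S := by
    rw [← Real.rpow_mul hS0, one_div_mul_cancel hp0.ne', Real.rpow_one]
  have split_sq : ∀ b : ℝ, 0 ≤ b → b ^ 2 = b ^ p * b ^ (2 - p) := fun b hb => by
    rw [← Real.rpow_add_of_nonneg hb hp0.le (by linarith), ← Real.rpow_natCast]
    norm_num
  refine Real.sqrt_le_iff.2 ⟨hR0, ?_⟩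
  calc ∑ j ∈ s, a j ^ 2 ≤ ∑ j ∈ s, |a j| ^ p * (S ^ (1 / p)) ^ (2 - p) := by
        refine Finset.sum_le_sum fun j hj => ?_
        rw [← sq_abs, split_sq _ (abs_nonneg _)]
        have hle : |a j| ≤ S ^ (1 / p) := by
          rw [← Real.rpow_le_rpow_iff (abs_nonneg _) hR0 hp0, hRp]
          exact Finset.single_le_sum (f := fun j => |a j| ^ p) (fun j _ => by positivity) hj
        have h2p : 0 ≤ 2 - p := by linarith
        gcongr
    _ = (S ^ (1 / p)) ^ 2 := by
        rw [← Finset.sum_mul, split_sq _ hR0, hRp]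

/-- Triangle inequality for the `ℓ²` norm over time, with the factor coming from
`‖a‖² ≤ 2‖a - b‖² + 2‖b‖²`. -/
theorem sqrt_sum_norm_sq_le {E ι : Type*} [SeminormedAddCommGroup E] (s : Finset ι) (a b : ι → E) :
    Real.sqrt (∑ t ∈ s, ‖a t‖ ^ 2) ≤
      Real.sqrt 2 * Real.sqrt (∑ t ∈ s, ‖a t - b t‖ ^ 2) +
        Real.sqrt (2 * ∑ t ∈ s, ‖b t‖ ^ 2) := by
  rw [← Real.sqrt_mul (by norm_num)]
  set A := 2 * ∑ t ∈ s, ‖a t - b t‖ ^ 2 with hA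
  set B := 2 * ∑ t ∈ s, ‖b t‖ ^ 2 with hB
  have hA0 : 0 ≤ A := by positivity
  have hB0 : 0 ≤ B := by positivity
  have hsum : ∑ t ∈ s, ‖a t‖ ^ 2 ≤ A + B := by
    rw [hA, hB, Finset.mul_sum, Finset.mul_sum, ← Finset.sum_add_distrib]
    refine Finset.sum_le_sum fun t _ => ?_
    have htri : ‖a t‖ ≤ ‖a t - b t‖ + ‖b t‖ := by
      simpa using norm_add_le (a t - b t) (b t)
    nlinarith [norm_nonneg (a t), sq_nonneg (‖a t - b t‖ - ‖b t‖),
      pow_le_pow_left₀ (norm_nonneg _) htri 2]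
  refine Real.sqrt_le_iff.2 ⟨by positivity, ?_⟩
  nlinarith [Real.sq_sqrt hA0, Real.sq_sqrt hB0,
    mul_nonneg (Real.sqrt_nonneg A) (Real.sqrt_nonneg B)]

/-- Tangent-line bound for `ln(1 + v/λ²)` in terms of any upper bound `Y` of `√v`. -/
theorem log_one_add_div_sq_le {v lam Y c : ℝ} (hv : 0 ≤ v) (hlam : 0 < lam) (hc : 0 < c)
    (hY : Real.sqrt v ≤ Y) :
    Real.log (1 + v / lam ^ 2) ≤ 2 * (Real.log c + (1 + Y / lam) / c - 1) := by
  have hY0 : 0 ≤ Y := (Real.sqrt_nonneg v).trans hY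
  have hsq : v ≤ Y ^ 2 := by
    rw [← Real.sq_sqrt hv]; gcongr
  have hpos : 0 < 1 + Y / lam := by positivity
  calc Real.log (1 + v / lam ^ 2) ≤ Real.log ((1 + Y / lam) ^ 2) := by
        refine Real.log_le_log (by positivity) ?_
        have : v / lam ^ 2 ≤ (Y / lam) ^ 2 := by rw [div_pow]; gcongr
        nlinarith [div_nonneg hY0 hlam.le]
    _ = 2 * Real.log (1 + Y / lam) := by rw [Real.log_pow]; norm_num
    _ ≤ _ := by
        have := Real.log_le_sub_one_of_pos (div_pos hpos hc)
        rw [Real.log_div hpos.ne' hc.ne'] at this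
        linarith

theorem integrable_rpow_of_le_one {Ω : Type*} [MeasurableSpace Ω] {μ : Measure Ω}
    [IsFiniteMeasure μ] {S : Ω → ℝ} (hS : Integrable S μ) (hS0 : ∀ ω, 0 ≤ S ω) {r : ℝ}
    (hr0 : 0 ≤ r) (hr1 : r ≤ 1) : Integrable (fun ω => S ω ^ r) μ := by
  refine ((integrable_const (1 : ℝ)).add hS).mono'
    (hS.aestronglyMeasurable.aemeasurable.pow_const r).aestronglyMeasurable
    (Filter.Eventually.of_forall fun ω => ?_)
  have h0 := hS0 ω
  rw [Real.norm_of_nonneg (by positivity)]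
  calc S ω ^ r ≤ (1 + S ω) ^ r := by gcongr; linarith
    _ ≤ (1 + S ω) ^ (1 : ℝ) := Real.rpow_le_rpow_of_exponent_le (by linarith) hr1
    _ = 1 + S ω := Real.rpow_one _

/-- Jensen's inequality for the concave power `r ∈ [0, 1]`. -/
theorem integral_rpow_le_rpow_integral {Ω : Type*} [MeasurableSpace Ω] {μ : Measure Ω}
    [IsProbabilityMeasure μ] {S : Ω → ℝ} (hS : Integrable S μ) (hS0 : ∀ ω, 0 ≤ S ω) {r : ℝ}
    (hr0 : 0 ≤ r) (hr1 : r ≤ 1) : ∫ ω, S ω ^ r ∂μ ≤ (∫ ω, S ω ∂μ) ^ r :=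
  (Real.concaveOn_rpow hr0 hr1).le_map_integral
    (Real.continuous_rpow_const hr0).continuousOn isClosed_Ici
    (Filter.Eventually.of_forall hS0) hS (integrable_rpow_of_le_one hS hS0 hr0 hr1)

theorem natFilt_le {Ω : Type} [m : MeasurableSpace Ω] {d : ℕ}
    {g : ℕ → Ω → EuclideanSpace ℝ (Fin d)} (hg : ∀ t, Measurable (g t)) (t : ℕ) :
    natFilt g t ≤ m :=
  iSup₂_le fun s _ => (hg s).comap_le

/-- Under coordinate-wise smoothness the gradient is `‖L‖_∞`-Lipschitz. -/
theorem norm_gradf_sub_le {d : ℕ} {f : EuclideanSpace ℝ (Fin d) → ℝ}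
    {gradf : EuclideanSpace ℝ (Fin d) → EuclideanSpace ℝ (Fin d)} {L : Fin d → ℝ}
    (hL : ∀ i, 0 < L i)
    (hsmooth : ∀ u v : EuclideanSpace ℝ (Fin d),
      |f u - f v - ∑ i, gradf v i * (u i - v i)| ≤ 1 / 2 * ∑ i, L i * (u i - v i) ^ 2)
    (y z : EuclideanSpace ℝ (Fin d)) :
    ‖gradf y - gradf z‖ ≤ (⨆ j, L j) * ‖y - z‖ := by
  have hle : ∀ i, L i ≤ ⨆ j, L j := le_ciSup (Set.finite_range L).bddAbove
  rcases isEmpty_or_nonempty (Fin d) with hd | ⟨⟨i⟩⟩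
  · simp [Subsingleton.elim y z]
  refine norm_gradient_sub_le_of_abs_remainder_le (f := f) ((hL i).trans_le (hle i))
    (fun u v => ?_) y z
  have hinner : inner ℝ (gradf v) (u - v) = ∑ i, gradf v i * (u i - v i) := by
    simp [PiLp.inner_apply, mul_comm]
  rw [hinner, EuclideanSpace.real_norm_sq_eq]
  refine (hsmooth u v).trans ?_
  rw [div_mul_eq_mul_div, Finset.mul_sum, Finset.mul_sum, Finset.sum_div]
  refine Finset.sum_le_sum fun j _ => ?_
  have := mul_le_mul_of_nonneg_right (hle j) (sq_nonneg (u j - v j))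
  simp only [PiLp.sub_apply]
  linarith

/-- Each AdaGrad-Norm step has length at most the learning rate. -/
theorem norm_adaNorm_step_le {Ω : Type} {d : ℕ} (g : ℕ → Ω → EuclideanSpace ℝ (Fin d))
    {γ lam : ℝ} (hγ : 0 < γ) (hlam : 0 < lam) {t : ℕ} (ht : 1 ≤ t) (ω : Ω) :
    ‖(γ / (lam + Real.sqrt (adaNormV g t ω))) • g t ω‖ ≤ γ := by
  have hg : ‖g t ω‖ ≤ Real.sqrt (adaNormV g t ω) :=
    Real.le_sqrt_of_sq_le (Finset.single_le_sum (f := fun s => ‖g s ω‖ ^ 2)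
      (fun s _ => by positivity) (Finset.mem_Icc.2 ⟨ht, le_rfl⟩))
  rw [norm_smul, Real.norm_of_nonneg (by positivity), div_mul_eq_mul_div,
    div_le_iff₀ (by positivity)]
  gcongr
  linarith

/-- under (A2) and (A4), for every `T ≥ 1` the AdaGrad-Norm
iterates satisfy
`E[ln(1 + v_T/λ²)] ≤ 2 ln(1 + (√2 ‖σ‖_p T^{1/p} + E[√(2u_T)])/λ) ≤ 2 ln K_T`,
where `u_T = ∑_{t=1}^T ‖∇f(x_t)‖₂²` and
`K_T = 1 + (√2 ‖σ‖_p T^{1/p} + 2‖∇f(x₁)‖₂ T^{1/2} + 2γ‖L‖_∞ T^{3/2})/λ`. -/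
theorem adagradNorm_log_accumulator_bound
    (d : ℕ) (Ω : Type) [MeasurableSpace Ω] (μ : Measure Ω) [IsProbabilityMeasure μ]
    (f : EuclideanSpace ℝ (Fin d) → ℝ)
    (gradf : EuclideanSpace ℝ (Fin d) → EuclideanSpace ℝ (Fin d))
    (g x : ℕ → Ω → EuclideanSpace ℝ (Fin d)) (x₁ : EuclideanSpace ℝ (Fin d))
    (γ lam p : ℝ) (L σ : Fin d → ℝ)
    (hγ : 0 < γ) (hlam : 0 < lam)
    (hgrad : ∀ y, HasGradientAt f (gradf y) y)
    (hL : ∀ i, 0 < L i)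
    (hsmooth : ∀ u v : EuclideanSpace ℝ (Fin d),
      |f u - f v - ∑ i, gradf v i * (u i - v i)| ≤ 1 / 2 * ∑ i, L i * (u i - v i) ^ 2)
    (hgmeas : ∀ t, Measurable (g t))
    (hx1 : ∀ ω, x 1 ω = x₁)
    (hxupd : ∀ t, 1 ≤ t → ∀ ω,
      x (t + 1) ω = x t ω - (γ / (lam + Real.sqrt (adaNormV g t ω))) • g t ω)
    (hp1 : 1 < p) (hp2 : p ≤ 2) (hσ : ∀ i, 0 ≤ σ i)
    (hnoise : ∀ t, 1 ≤ t → ∀ i : Fin d,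
      Integrable (fun ω => |g t ω i - gradf (x t ω) i| ^ p) μ ∧
      ∀ᵐ ω ∂μ,
        (μ[(fun ω' => |g t ω' i - gradf (x t ω') i| ^ p) | natFilt g (t - 1)]) ω ≤ σ i ^ p) :
    ∀ T : ℕ, 1 ≤ T →
      (∫ ω, Real.log (1 + adaNormV g T ω / lam ^ 2) ∂μ) ≤
        2 * Real.log (1 + (Real.sqrt 2 * (∑ i, σ i ^ p) ^ (1 / p) * (T : ℝ) ^ (1 / p) +
          ∫ ω, Real.sqrt (2 * ∑ t ∈ Finset.Icc 1 T, ‖gradf (x t ω)‖ ^ 2) ∂μ) / lam) ∧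
      2 * Real.log (1 + (Real.sqrt 2 * (∑ i, σ i ^ p) ^ (1 / p) * (T : ℝ) ^ (1 / p) +
          ∫ ω, Real.sqrt (2 * ∑ t ∈ Finset.Icc 1 T, ‖gradf (x t ω)‖ ^ 2) ∂μ) / lam) ≤
        2 * Real.log (1 + (Real.sqrt 2 * (∑ i, σ i ^ p) ^ (1 / p) * (T : ℝ) ^ (1 / p) +
          2 * ‖gradf x₁‖ * (T : ℝ) ^ ((1 : ℝ) / 2) +
          2 * γ * (⨆ j, L j) * (T : ℝ) ^ ((3 : ℝ) / 2)) / lam) := by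
  set M := ⨆ j, L j with hM
  have hM0 : 0 ≤ M := Real.iSup_nonneg fun i => (hL i).le
  have hp0 : 0 < p := by linarith
  have hp_inv : 1 / p ≤ 1 := (div_le_one hp0).2 hp1.le
  have hlip := norm_gradf_sub_le hL hsmooth
  have hgrad_cont : Continuous gradf :=
    (LipschitzWith.of_dist_le_mul (K := ⟨M, hM0⟩) fun y z => by
      rw [dist_eq_norm, dist_eq_norm]
      exact hlip y z).continuous
  have hv_meas : ∀ t, Measurable (adaNormV g t) := fun t =>
    Finset.measurable_sum _ fun s _ => (hgmeas s).norm.pow_const 2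
  have hx_meas : ∀ t, 1 ≤ t → Measurable (x t) := fun t ht => by
    induction t, ht using Nat.le_induction with
    | base => rw [funext hx1]; exact measurable_const
    | succ t ht ih =>
      rw [funext (hxupd t ht)]
      exact ih.sub ((measurable_const.div (measurable_const.add (hv_meas t).sqrt)).smul (hgmeas t))
  have hx_dist : ∀ t, 1 ≤ t → ∀ ω, ‖x t ω - x₁‖ ≤ γ * t := fun t ht ω => by
    induction t, ht using Nat.le_induction with
    | base => rw [hx1]; simpa using hγ.le
    | succ t ht ih =>
      rw [hxupd t ht, sub_right_comm]
      have := norm_adaNorm_step_le g hγ hlam ht ω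
      push_cast
      linarith [norm_sub_le (x t ω - x₁) ((γ / (lam + Real.sqrt (adaNormV g t ω))) • g t ω)]
  intro T hT
  have hgrad_le : ∀ t ∈ Finset.Icc 1 T, ∀ ω, ‖gradf (x t ω)‖ ≤ ‖gradf x₁‖ + M * (γ * T) := by
    intro t ht ω
    obtain ⟨ht1, htT⟩ := Finset.mem_Icc.1 ht
    have hbound : M * ‖x t ω - x₁‖ ≤ M * (γ * T) := by
      have := hx_dist t ht1 ω
      have : (t : ℝ) ≤ T := by exact_mod_cast htT
      gcongr
      nlinarith
    linarith [norm_sub_norm_le (gradf (x t ω)) (gradf x₁), hlip (x t ω) x₁]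
  set U : Ω → ℝ := fun ω => Real.sqrt (2 * ∑ t ∈ Finset.Icc 1 T, ‖gradf (x t ω)‖ ^ 2) with hU
  have hU0 : ∀ ω, 0 ≤ U ω := fun ω => Real.sqrt_nonneg _
  have hU_le : ∀ ω, U ω ≤ 2 * ‖gradf x₁‖ * (T : ℝ) ^ ((1 : ℝ) / 2) +
      2 * γ * M * (T : ℝ) ^ ((3 : ℝ) / 2) := by
    intro ω
    have hT32 : (T : ℝ) ^ ((3 : ℝ) / 2) = T * Real.sqrt T := by
      rw [Real.sqrt_eq_rpow, ← Real.rpow_one_add' (by positivity) (by norm_num)]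
      norm_num
    rw [← Real.sqrt_eq_rpow, hT32]
    refine Real.sqrt_le_iff.2 ⟨by positivity, ?_⟩
    calc 2 * ∑ t ∈ Finset.Icc 1 T, ‖gradf (x t ω)‖ ^ 2
        ≤ 2 * ∑ t ∈ Finset.Icc 1 T, (‖gradf x₁‖ + M * (γ * T)) ^ 2 := by
          gcongr with t ht
          exact hgrad_le t ht ω
      _ = 2 * (‖gradf x₁‖ + M * (γ * T)) ^ 2 * T := by
          simp; ring
      _ ≤ 4 * (‖gradf x₁‖ + M * (γ * T)) ^ 2 * T := by gcongr; norm_num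
      _ = 4 * (‖gradf x₁‖ + M * (γ * T)) ^ 2 * Real.sqrt T ^ 2 := by
          rw [Real.sq_sqrt (by positivity)]
      _ = _ := by ring
  have hU_int : Integrable U μ := by
    refine Integrable.of_bound (Measurable.aestronglyMeasurable ?_) _
      (Filter.Eventually.of_forall fun ω => (Real.norm_of_nonneg (hU0 ω)).trans_le (hU_le ω))
    refine (measurable_const.mul (Finset.measurable_sum _ fun t ht => ?_)).sqrt
    exact (hgrad_cont.measurable.comp (hx_meas t (Finset.mem_Icc.1 ht).1)).norm.pow_const 2
  have hEU0 : 0 ≤ ∫ ω, U ω ∂μ := integral_nonneg hU0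
  have hnoise_le : ∀ t, 1 ≤ t → ∀ i, ∫ ω, |g t ω i - gradf (x t ω) i| ^ p ∂μ ≤ σ i ^ p := by
    intro t ht i
    rw [← integral_condExp (natFilt_le hgmeas (t - 1))]
    simpa using integral_mono_ae integrable_condExp (integrable_const (σ i ^ p)) (hnoise t ht i).2
  set S : Ω → ℝ := fun ω => ∑ t ∈ Finset.Icc 1 T, ∑ i, |g t ω i - gradf (x t ω) i| ^ p with hS
  have hS0 : ∀ ω, 0 ≤ S ω := fun ω => by positivity
  have hS_int : Integrable S μ :=
    integrable_finsetSum _ fun t ht => integrable_finsetSum _ fun i _ =>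
      (hnoise t (Finset.mem_Icc.1 ht).1 i).1
  have hES : ∫ ω, S ω ∂μ ≤ (∑ i, σ i ^ p) * T := by
    rw [integral_finsetSum _ fun t ht => integrable_finsetSum _ fun i _ =>
      (hnoise t (Finset.mem_Icc.1 ht).1 i).1]
    calc _ ≤ ∑ t ∈ Finset.Icc 1 T, ∑ i, σ i ^ p := by
          refine Finset.sum_le_sum fun t ht => ?_
          have ht1 := (Finset.mem_Icc.1 ht).1
          rw [integral_finsetSum _ fun i _ => (hnoise t ht1 i).1]
          exact Finset.sum_le_sum fun i _ => hnoise_le t ht1 i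
      _ = _ := by simp [mul_comm]
  have hσ_sum : 0 ≤ ∑ i, σ i ^ p := Finset.sum_nonneg fun i _ => Real.rpow_nonneg (hσ i) p
  have hES_root : ∫ ω, S ω ^ (1 / p) ∂μ ≤ (∑ i, σ i ^ p) ^ (1 / p) * (T : ℝ) ^ (1 / p) := by
    rw [← Real.mul_rpow hσ_sum (by positivity)]
    refine (integral_rpow_le_rpow_integral hS_int hS0 (by positivity) hp_inv).trans ?_
    have : 0 ≤ ∫ ω, S ω ∂μ := integral_nonneg hS0
    gcongr
  have hv_le : ∀ ω, Real.sqrt (adaNormV g T ω) ≤ Real.sqrt 2 * S ω ^ (1 / p) + U ω := by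
    intro ω
    refine (sqrt_sum_norm_sq_le _ (fun t => g t ω) fun t => gradf (x t ω)).trans ?_
    have := sqrt_sum_sq_le_rpow_sum_rpow (Finset.Icc 1 T ×ˢ (Finset.univ : Finset (Fin d)))
      (fun j => g j.1 ω j.2 - gradf (x j.1 ω) j.2) hp0 hp2
    rw [Finset.sum_product, Finset.sum_product] at this
    gcongr
    simpa only [EuclideanSpace.real_norm_sq_eq, PiLp.sub_apply] using this
  have hS_root_int := integrable_rpow_of_le_one hS_int hS0 (by positivity) hp_inv
  constructor
  · set c := 1 + (Real.sqrt 2 * (∑ i, σ i ^ p) ^ (1 / p) * (T : ℝ) ^ (1 / p) +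
      ∫ ω, U ω ∂μ) / lam with hc
    have hc0 : 0 < c := by positivity
    have hY_int : Integrable (fun ω => Real.sqrt 2 * S ω ^ (1 / p) + U ω) μ :=
      (hS_root_int.const_mul _).add hU_int
    have hEY : ∫ ω, (Real.sqrt 2 * S ω ^ (1 / p) + U ω) ∂μ ≤ (c - 1) * lam := by
      rw [integral_add (hS_root_int.const_mul _) hU_int, integral_const_mul, hc,
        add_sub_cancel_left, div_mul_cancel₀ _ hlam.ne', mul_assoc]
      gcongr
    have hv0 : ∀ ω, 0 ≤ adaNormV g T ω := fun ω => Finset.sum_nonneg fun s _ => by positivity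
    have h1 : Integrable (fun ω => 1 + (Real.sqrt 2 * S ω ^ (1 / p) + U ω) / lam) μ :=
      (integrable_const 1).add (hY_int.div_const lam)
    have h2 : Integrable (fun ω => Real.log c +
        (1 + (Real.sqrt 2 * S ω ^ (1 / p) + U ω) / lam) / c) μ :=
      (integrable_const _).add (h1.div_const c)
    calc ∫ ω, Real.log (1 + adaNormV g T ω / lam ^ 2) ∂μ
        ≤ ∫ ω, 2 * (Real.log c +
            (1 + (Real.sqrt 2 * S ω ^ (1 / p) + U ω) / lam) / c - 1) ∂μ := by
          refine integral_mono_of_nonneg (Filter.Eventually.of_forall fun ω => ?_)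
            ((h2.sub (integrable_const 1)).const_mul 2)
            (Filter.Eventually.of_forall fun ω =>
              log_one_add_div_sq_le (hv0 ω) hlam hc0 (hv_le ω))
          have := div_nonneg (hv0 ω) (sq_nonneg lam)
          exact Real.log_nonneg (by linarith)
      _ = 2 * (Real.log c +
            (1 + (∫ ω, (Real.sqrt 2 * S ω ^ (1 / p) + U ω) ∂μ) / lam) / c - 1) := by
          rw [integral_const_mul, integral_sub h2 (integrable_const 1),
            integral_add (integrable_const _) (h1.div_const c), integral_div,
            integral_add (integrable_const 1) (hY_int.div_const lam), integral_div]
          simp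
      _ ≤ 2 * Real.log c := by
          have : (1 + (∫ ω, (Real.sqrt 2 * S ω ^ (1 / p) + U ω) ∂μ) / lam) / c ≤ 1 := by
            rw [div_le_one hc0]
            linarith [(div_le_iff₀ hlam).2 hEY]
          linarith
  · have hEU : ∫ ω, U ω ∂μ ≤ 2 * ‖gradf x₁‖ * (T : ℝ) ^ ((1 : ℝ) / 2) +
        2 * γ * M * (T : ℝ) ^ ((3 : ℝ) / 2) := by
      simpa using integral_mono hU_int (integrable_const _) hU_le
    gcongr 2 * Real.log (1 + ?_ / lam)
    linarith
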